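/- Let G be a finite group of order 240 having exactly one element of order 2 and possessing a normal subgroup N isomorphic to SL(2,5) (these conditions characterize the non-split extension SL(2,5).C_2), and let π : G → S_5 be a surjective homomorphism whose kernel is the center of G. Let L, K_1, K_2 ≤ S_5 be the subgroups generated respectively by (1 3); by (1 3) and (4 5); and by (1 2 3 4) and (1 2)(3 4). Then π^{-1}(L) is cyclic of order 4, π^{-1}(K_1) is isomorphic to the quaternion group Q_8 of order 8, π^{-1}(K_2) is isomorphic to the generalized quaternion group Q_16 of order 16, π^{-1}(L) = π^{-1}(K_1) ∩ π^{-1}(K_2), and π^{-1}(K_1) together with π^{-1}(K_2) generate G. -/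

import Mathlib

open Equiv

/-- The subgroup `L ≤ S₅` generated by the transposition (1 3) (0-indexed: (0 2)). -/
def L : Subgroup (Perm (Fin 5)) := Subgroup.closure {swap 0 2}

/-- The subgroup `K₁ ≤ S₅` generated by (1 3) and (4 5) (0-indexed: (0 2) and (3 4)). -/
def K₁ : Subgroup (Perm (Fin 5)) := Subgroup.closure {swap 0 2, swap 3 4}

/-- The subgroup `K₂ ≤ S₅` generated by the 4-cycle (1 2 3 4) and the double
transposition (1 2)(3 4) (0-indexed: (0 1 2 3) and (0 1)(2 3)). -/
def K₂ : Subgroup (Perm (Fin 5)) :=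
  Subgroup.closure {swap 0 1 * swap 1 2 * swap 2 3, swap 0 1 * swap 2 3}

/-- Homomorphism from a generalised quaternion group given by generators and relations. -/
lemma quat_equiv {G : Type*} [Group G] (m k : ℕ) (hm : m = 2 ^ k) (hm2 : 2 ≤ m) (A X : G)
    (h1 : A ^ (2 * m) = 1) (h2 : X ^ 2 = A ^ m) (h3 : A * X * A = X) (h4 : A ^ m ≠ 1) :
    Nonempty (Subgroup.closure {A, X} ≃* QuaternionGroup m) := by
  have : NeZero (2 * m) := ⟨by omega⟩
  have hord : orderOf A = 2 * m := by
    have : Fact (Nat.Prime 2) := ⟨Nat.prime_two⟩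
    have := orderOf_eq_prime_pow (x := A) (p := 2) (n := k) (by rwa [← hm])
      (by rw [pow_succ, ← hm, mul_comm]; exact h1)
    rw [this, pow_succ, ← hm, mul_comm]
  let f : ZMod (2 * m) → G := fun i => A ^ i.val
  have fnat : ∀ i : ℕ, f (i : ZMod (2 * m)) = A ^ i := by
    intro i
    simp only [f, ZMod.val_natCast]
    rw [← hord, pow_mod_orderOf]
  have fadd : ∀ i j, f (i + j) = f i * f j := by
    intro i j
    simp only [f, ZMod.val_add]
    rw [← pow_add]
    generalize i.val + j.val = t
    rw [← hord, pow_mod_orderOf]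
  have fX' : ∀ i : ℕ, A ^ i * X * A ^ i = X := by
    intro i
    induction i with
    | zero => simp
    | succ i ih =>
      calc A ^ (i + 1) * X * A ^ (i + 1) = A ^ i * (A * X * A) * A ^ i := by
            rw [pow_succ]; nth_rewrite 2 [← pow_succ]; rw [pow_succ']; simp only [mul_assoc]
        _ = X := by rw [h3, ih]
  have fX : ∀ i, f i * X = X * f (-i) := by
    intro i
    have : f i * f (-i) = 1 := by rw [← fadd, add_neg_cancel]; simp [f]
    rw [eq_inv_of_mul_eq_one_right this]
    exact eq_mul_inv_of_mul_eq (fX' i.val)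
  let g : QuaternionGroup m → G := fun q => match q with
    | .a i => f i
    | .xa i => X * f i
  let φ : QuaternionGroup m →* G := MonoidHom.mk' g (by
    rintro (i | i) (j | j)
    · exact fadd i j
    · change X * f (j - i) = f i * (X * f j)
      rw [← mul_assoc, fX, mul_assoc, ← fadd]; congr 2; ring
    · change X * f (i + j) = X * f i * f j
      rw [fadd, mul_assoc]
    · change f (m + j - i) = X * f i * (X * f j)
      rw [← mul_assoc, mul_assoc X (f i) X, fX, ← mul_assoc, ← sq, h2, ← fnat, ← fadd, ← fadd]
      congr 1; ring)
  have hinj : Function.Injective φ := by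
    rw [injective_iff_map_eq_one]
    rintro (i | i) h
    · change A ^ i.val = 1 at h
      have h' := orderOf_dvd_of_pow_eq_one h
      rw [hord] at h'
      have := Nat.eq_zero_of_dvd_of_lt h' (ZMod.val_lt i)
      rw [ZMod.val_eq_zero] at this
      rw [this]; rfl
    · exfalso
      change X * A ^ i.val = 1 at h
      have hc : Commute A X := by
        rw [eq_inv_of_mul_eq_one_left h]
        exact (Commute.self_pow A _).inv_right
      have : A ^ 2 = 1 := by
        rw [hc.eq, mul_assoc] at h3
        rw [sq]; simpa using h3
      have := Nat.le_of_dvd (by norm_num) (orderOf_dvd_of_pow_eq_one this)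
      omega
  have hA : φ (.a 1) = A := by
    change f 1 = A
    have := fnat 1
    simpa using this
  have hX : φ (.xa 0) = X := by
    change X * f 0 = X
    simp [f]
  have hr : φ.range = Subgroup.closure {A, X} := by
    apply le_antisymm
    · have ha : A ∈ Subgroup.closure {A, X} := Subgroup.subset_closure (by simp)
      have hx : X ∈ Subgroup.closure {A, X} := Subgroup.subset_closure (by simp)
      rintro _ ⟨i | i, rfl⟩
      · exact pow_mem ha _
      · exact mul_mem hx (pow_mem ha _)
    · rw [Subgroup.closure_le]
      rintro x (rfl | rfl)
      · exact ⟨_, hA⟩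
      · exact ⟨_, hX⟩
  rw [← hr]
  exact ⟨(MonoidHom.ofInjective hinj).symm⟩

lemma K1_elems (x : Perm (Fin 5)) (hx : x ∈ K₁) :
    x = 1 ∨ x = swap 0 2 ∨ x = swap 3 4 ∨ x = swap 0 2 * swap 3 4 := by
  unfold K₁ at hx
  induction hx using Subgroup.closure_induction with
  | mem x hx => rcases hx with rfl | rfl <;> simp
  | one => simp
  | mul x y _ _ hx hy =>
    rcases hx with rfl | rfl | rfl | rfl <;> rcases hy with rfl | rfl | rfl | rfl <;> decide
  | inv x _ hx => rcases hx with rfl | rfl | rfl | rfl <;> decide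

lemma K2_fix (x : Perm (Fin 5)) (hx : x ∈ K₂) : x 4 = 4 := by
  have : K₂ ≤ MulAction.stabilizer (Perm (Fin 5)) (4 : Fin 5) := by
    unfold K₂
    rw [Subgroup.closure_le]
    rintro x (rfl | rfl) <;> (rw [SetLike.mem_coe, MulAction.mem_stabilizer_iff]; decide)
  exact this hx

lemma L_eq : L = K₁ ⊓ K₂ := by
  apply le_antisymm
  · unfold L
    rw [Subgroup.closure_le]
    rintro x rfl
    refine ⟨Subgroup.subset_closure (by simp), ?_⟩
    have : (swap 0 2 : Perm (Fin 5)) =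
      (swap 0 1 * swap 1 2 * swap 2 3) * (swap 0 1 * swap 2 3) := by decide
    rw [this]
    exact mul_mem (Subgroup.subset_closure (by simp)) (Subgroup.subset_closure (by simp))
  · rintro x ⟨h1, h2⟩
    have h2 := K2_fix x h2
    rcases K1_elems x h1 with rfl | rfl | rfl | rfl
    · exact one_mem _
    · exact Subgroup.subset_closure (by simp)
    · exact absurd h2 (by decide)
    · exact absurd h2 (by decide)

lemma K_sup : K₁ ⊔ K₂ = ⊤ := by
  have h34 : (swap 3 4 : Perm (Fin 5)) ∈ K₁ ⊔ K₂ :=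
    Subgroup.mem_sup_left (Subgroup.subset_closure (by simp))
  have hc : (swap 0 1 * swap 1 2 * swap 2 3 : Perm (Fin 5)) ∈ K₁ ⊔ K₂ :=
    Subgroup.mem_sup_right (Subgroup.subset_closure (by simp))
  have h5 : finRotate 5 ∈ K₁ ⊔ K₂ := by
    have : finRotate 5 = (swap 0 1 * swap 1 2 * swap 2 3) * (swap 3 4 : Perm (Fin 5)) := by decide
    rw [this]; exact mul_mem hc h34
  have := Equiv.Perm.closure_cycle_adjacent_swap (σ := finRotate 5) isCycle_finRotate
    support_finRotate (3 : Fin 5)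
  rw [eq_top_iff, ← this, Subgroup.closure_le]
  rintro x (rfl | rfl)
  · exact h5
  · have : finRotate 5 3 = 4 := by decide
    rw [this]; exact h34

/-- Let `G` be the non-split extension `SL(2,5).C₂` (characterized as a group of order
240 with exactly one element of order 2 and a normal subgroup `N ≅ SL(2,5)`), and let
`π : G → S₅` be a surjection with kernel the center of `G`. Then `π⁻¹(L)` is cyclic of
order 4, `π⁻¹(K₁) ≅ Q₈`, `π⁻¹(K₂) ≅ Q₁₆`, `π⁻¹(L) = π⁻¹(K₁) ∩ π⁻¹(K₂)`, and `π⁻¹(K₁)`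
together with `π⁻¹(K₂)` generate `G`. -/
theorem stmt12 {G : Type*} [Group G] [Finite G]
    (hcard : Nat.card G = 240)
    (huniq : ∃! g : G, orderOf g = 2)
    (N : Subgroup G) (hN : N.Normal)
    (hiso : Nonempty (N ≃* Matrix.SpecialLinearGroup (Fin 2) (ZMod 5)))
    (π : G →* Perm (Fin 5)) (hsurj : Function.Surjective π)
    (hker : π.ker = Subgroup.center G) :
    (IsCyclic (Subgroup.comap π L) ∧ Nat.card (Subgroup.comap π L) = 4) ∧
    Nonempty (Subgroup.comap π K₁ ≃* QuaternionGroup 2) ∧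
    Nonempty (Subgroup.comap π K₂ ≃* QuaternionGroup 4) ∧
    Subgroup.comap π L = Subgroup.comap π K₁ ⊓ Subgroup.comap π K₂ ∧
    Subgroup.comap π K₁ ⊔ Subgroup.comap π K₂ = ⊤ := by
  obtain ⟨z, hz, hzu⟩ := huniq
  have hk2 : Nat.card π.ker = 2 := by
    have h := π.ker.card_mul_index
    rw [Subgroup.index_ker, MonoidHom.range_eq_top.2 hsurj, hcard] at h
    have : Nat.card (⊤ : Subgroup (Perm (Fin 5))) = 120 := by
      rw [Subgroup.card_top, Nat.card_perm, Nat.card_fin]; rfl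
    rw [this] at h
    omega
  have hz1 : z ≠ 1 := by rintro rfl; simp at hz
  have hkz : ∀ g, g ∈ π.ker → g = 1 ∨ g = z := by
    intro g hg
    have h : g ^ 2 = 1 := by
      have := pow_card_eq_one' (x := (⟨g, hg⟩ : π.ker))
      rw [hk2] at this
      simpa [Subtype.ext_iff] using this
    by_cases h1 : g = 1
    · exact Or.inl h1
    · exact Or.inr (hzu g (orderOf_eq_prime h h1))
  have hzk : z ∈ π.ker := by
    obtain ⟨⟨g, hg⟩, h1⟩ : ∃ g : π.ker, g ≠ 1 := by
      have : Nontrivial π.ker := (Finite.one_lt_card_iff_nontrivial).1 (by omega)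
      exact exists_ne 1
    rcases hkz g hg with rfl | rfl
    · exact absurd rfl h1
    · exact hg
  have key : ∀ g, π g ≠ 1 → (π g) ^ 2 = 1 → g ^ 2 = z := by
    intro g h1 h2
    have : g ^ 2 ∈ π.ker := by rw [MonoidHom.mem_ker, map_pow, h2]
    refine (hkz _ this).resolve_left fun h => ?_
    have hg : g ≠ 1 := by rintro rfl; simp at h1
    rw [hzu g (orderOf_eq_prime h hg)] at h1
    exact h1 hzk
  have hcl : ∀ S : Set G, z ∈ Subgroup.closure S →
      Subgroup.comap π (Subgroup.closure (π '' S)) = Subgroup.closure S := by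
    intro S hS
    rw [← MonoidHom.map_closure, Subgroup.comap_map_eq, sup_eq_left]
    intro g hg
    rcases hkz g hg with rfl | rfl
    · exact one_mem _
    · exact hS
  have hz2 : z ^ 2 = 1 := by rw [← hz, pow_orderOf_eq_one]
  have main : ∀ (m k : ℕ) (r s : Perm (Fin 5)), m = 2 ^ (k + 1) → r ^ (2 ^ k) ≠ 1 → r ^ m = 1 →
      s ≠ 1 → s ^ 2 = 1 → s * r ≠ 1 → (s * r) ^ 2 = 1 →
      Nonempty (Subgroup.comap π (Subgroup.closure {r, s}) ≃* QuaternionGroup m) := by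
    intro m k r s hm hr1 hr2 hs1 hs2 ht1 ht2
    obtain ⟨A, rfl⟩ := hsurj r
    obtain ⟨X, rfl⟩ := hsurj s
    have hX := key X hs1 hs2
    have hXA := key (X * A) (by simpa using ht1) (by simpa using ht2)
    have hA : A ^ m = z := by
      rw [hm, pow_succ, pow_mul]
      refine key _ (by simpa using hr1) ?_
      rw [map_pow, ← pow_mul, ← pow_succ, ← hm, hr2]
    have hS := hcl {A, X} (by
      rw [← hA]; exact pow_mem (Subgroup.subset_closure (by simp)) _)
    rw [Set.image_pair] at hS
    rw [hS]
    refine quat_equiv m (k + 1) hm ?_ A X ?_ (hX.trans hA.symm) ?_ (by rwa [hA])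
    · rw [hm, pow_succ]; have := Nat.one_le_two_pow (n := k); omega
    · rw [mul_comm, pow_mul, hA, hz2]
    · rw [← hX, sq, sq] at hXA
      apply mul_left_cancel (a := X)
      rw [← hXA]; simp only [mul_assoc]
  refine ⟨?_, ?_, ?_, ?_, ?_⟩
  · obtain ⟨X, hX⟩ := hsurj (swap 0 2)
    have hX2 := key X (by rw [hX]; decide) (by rw [hX]; decide)
    have hS := hcl {X} (by
      rw [← hX2]; exact pow_mem (Subgroup.subset_closure (by simp)) _)
    rw [Set.image_singleton, hX, ← Subgroup.zpowers_eq_closure X] at hS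
    have hL : Subgroup.comap π L = Subgroup.zpowers X := hS
    rw [hL]
    refine ⟨inferInstance, ?_⟩
    rw [Nat.card_zpowers]
    have : Fact (Nat.Prime 2) := ⟨Nat.prime_two⟩
    refine orderOf_eq_prime_pow (p := 2) (n := 1) ?_ ?_
    · rwa [pow_one, hX2]
    · rw [pow_succ, pow_one, pow_mul, hX2, hz2]
  · exact main 2 0 (swap 0 2) (swap 3 4) rfl (by decide) (by decide) (by decide) (by decide) (by decide) (by decide)
  · exact main 4 1 (swap 0 1 * swap 1 2 * swap 2 3) (swap 0 1 * swap 2 3) rfl (by decide) (by decide) (by decide) (by decide) (by decide) (by decide)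
  · rw [L_eq, Subgroup.comap_inf]
  · rw [Subgroup.comap_sup_eq _ _ _ hsurj, K_sup, Subgroup.comap_top]
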